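/- arXiv:2312.02426 — 5 statements merged into one kernel-verified Lean document; each statement's English description precedes it below -/
import Mathlib

section
/- Fix an integer k ≥ 2 and let A = {m^k : m ∈ ℕ, m ≥ 1} be the set of positive k-th powers. Then the unseeded winning sequence w^A is not eventually periodic: there are no integers p ≥ 1 and N ≥ 0 such that w^A(n) = w^A(n + p) for all n ≥ N. -/
open Classical in
/-- The winning sequence on ℕ, where `seed` gives values at negative positions. -/
noncomputable def subW (A : Set ℕ) (seed : ℤ → ℕ) : ℕ → ℕ := fun n =>
  Nat.strongRecOn n (fun n ih =>
    if ∃ x ∈ A, (if h : 0 < x ∧ x ≤ n then ih (n - x) (by omega)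
                 else seed ((n : ℤ) - (x : ℤ))) = 0
    then 1 else 0)

/-- The winning sequence `w^{A,seed} : ℤ → ℕ`. -/
noncomputable def W (A : Set ℕ) (seed : ℤ → ℕ) : ℤ → ℕ := fun n =>
  if 0 ≤ n then subW A seed n.toNat else seed n

/-- The trivial seed (all ones), giving the unseeded sequence `w^A`. -/
def one : ℤ → ℕ := fun _ => 1

/-- The seed function determined by a string `S ∈ {0,1}^L`: `w(-i) = S_i` for `1 ≤ i ≤ L`,
and `w(n) = 1` for `n < -L`. -/
def seedExt (L : ℕ) (S : ℕ → Bool) : ℤ → ℕ := fun j =>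
  if -(L : ℤ) ≤ j ∧ j < 0 then (if S ((-j).toNat - 1) then 1 else 0) else 1

/-- `w` is eventually periodic over `p`. -/
def PeriodicOver (w : ℤ → ℕ) (p : ℕ) : Prop :=
  ∃ N : ℕ, ∀ n : ℤ, (N : ℤ) ≤ n → w n = w (n + p)

/-- The (eventual) period: the least `p ≥ 1` over which `w` is eventually periodic. -/
noncomputable def per (w : ℤ → ℕ) : ℕ := sInf {p : ℕ | 0 < p ∧ PeriodicOver w p}

/-- The preperiod: the least `N` that works for `p = per w`. -/
noncomputable def preper (w : ℤ → ℕ) : ℕ :=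
  sInf {N : ℕ | ∀ n : ℤ, (N : ℤ) ≤ n → w n = w (n + per w)}

theorem subW_one_eq_zero_iff (A : Set ℕ) (n : ℕ) :
    subW A one n = 0 ↔ ∀ x ∈ A, 0 < x → x ≤ n → subW A one (n - x) ≠ 0 := by
  classical
  have unfold_subW : subW A one n =
      if ∃ x ∈ A, (if 0 < x ∧ x ≤ n then subW A one (n - x)
        else one ((n : ℤ) - (x : ℤ))) = 0 then 1 else 0 := by
    unfold subW Nat.strongRecOn
    rw [WellFounded.fix_eq]
    simp only [dite_eq_ite]
  rw [unfold_subW]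
  constructor
  · intro h x hx h0 hn hz
    rw [if_pos ⟨x, hx, by rw [if_pos ⟨h0, hn⟩, hz]⟩] at h
    exact one_ne_zero h
  · intro h
    rw [if_neg]
    rintro ⟨x, hx, hz⟩
    split_ifs at hz with hc
    · exact h x hx hc.1 hc.2 hz
    · exact one_ne_zero hz

theorem W_natCast (A : Set ℕ) (seed : ℤ → ℕ) (n : ℕ) : W A seed n = subW A seed n := by
  simp [W]

theorem pow_add_lt_succ_pow {k : ℕ} (hk : 2 ≤ k) (N : ℕ) (hN : 0 < N) :
    N ^ k + N < (N + 1) ^ k := by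
  obtain ⟨j, rfl⟩ := Nat.exists_eq_add_of_le hk
  have h : N ^ j ≤ (N + 1) ^ j := Nat.pow_le_pow_left (by omega) j
  have h1 : 1 ≤ N ^ j := Nat.one_le_pow _ _ hN
  rw [pow_add, pow_add]
  nlinarith [Nat.mul_le_mul_left (N * N) h, Nat.mul_le_mul_left N (h1.trans h)]

/-- There are losing positions arbitrarily far out in the `k`-th power subtraction game. -/
theorem exists_subW_pow_eq_zero {k : ℕ} (hk : 2 ≤ k) (N : ℕ) :
    ∃ n, N ≤ n ∧ subW {y : ℕ | ∃ m : ℕ, 1 ≤ m ∧ y = m ^ k} one n = 0 := by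
  rcases Nat.eq_zero_or_pos N with rfl | hN
  · refine ⟨0, le_rfl, (subW_one_eq_zero_iff _ _).2 fun x _ h0 hn => ?_⟩
    omega
  by_contra! hall
  refine hall (N ^ k + N) (by omega) ((subW_one_eq_zero_iff _ _).2 ?_)
  rintro x ⟨m, hm, rfl⟩ - hle
  refine hall _ ?_
  have hmN : m ≤ N := by
    by_contra! hlt
    have := Nat.pow_le_pow_left (Nat.succ_le_of_lt hlt) k
    have := pow_add_lt_succ_pow hk N hN
    simp only [Nat.succ_eq_add_one] at *
    omega
  have := Nat.pow_le_pow_left hmN k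
  omega

/-- for `A` the set of positive `k`-th powers (`k ≥ 2`), the unseeded
winning sequence is not eventually periodic. -/
theorem stmt_1 (k : ℕ) (hk : 2 ≤ k) :
    ¬ ∃ (p N : ℕ), 1 ≤ p ∧
      ∀ n : ℤ, (N : ℤ) ≤ n →
        W {y : ℕ | ∃ m : ℕ, 1 ≤ m ∧ y = m ^ k} one n
          = W {y : ℕ | ∃ m : ℕ, 1 ≤ m ∧ y = m ^ k} one (n + p) := by
  rintro ⟨p, N, hp, hper⟩
  set A := {y : ℕ | ∃ m : ℕ, 1 ≤ m ∧ y = m ^ k} with hA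
  obtain ⟨n, hn, hz⟩ := exists_subW_pow_eq_zero hk N
  have shift (j : ℕ) : subW A one (n + j * p) = 0 := by
    induction j with
    | zero => simpa using hz
    | succ j ih =>
      have h := hper ((n + j * p : ℕ) : ℤ) (by exact_mod_cast hn.trans (Nat.le_add_right _ _))
      rw [← Nat.cast_add, W_natCast, W_natCast, ih] at h
      rw [Nat.succ_mul, ← Nat.add_assoc]
      exact h.symm
  have hpk : n + p ^ (k - 1) * p = n + p ^ k := by
    rw [← pow_succ, Nat.sub_add_cancel (by omega)]
  have hlose := shift (p ^ (k - 1))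
  rw [hpk, subW_one_eq_zero_iff] at hlose
  refine hlose (p ^ k) ⟨p, hp, rfl⟩ (Nat.pow_pos hp) (Nat.le_add_left _ _) ?_
  rw [Nat.add_sub_cancel]
  exact hz
end

section
/- Let A be a finite set of positive integers with |A| ≥ 2, let a₁ = min A, let α = max A, let α′ be the largest element of A \ {α}, and set β = min(α, a₁ + α′). Then preper(A) + per(A) ≤ (β + 1)·2^{α − |A|}. -/
theorem subW_eq (A : Set ℕ) (hpos : ∀ x ∈ A, 0 < x) (seed : ℤ → ℕ) (n : ℕ)
    [Decidable (∃ x ∈ A, W A seed ((n : ℤ) - x) = 0)] :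
    subW A seed n = if ∃ x ∈ A, W A seed ((n : ℤ) - x) = 0 then 1 else 0 := by
  have key : ∀ x ∈ A, (if 0 < x ∧ x ≤ n then subW A seed (n - x) else seed ((n : ℤ) - (x : ℤ)))
      = W A seed ((n : ℤ) - x) := by
    intro x hx
    have hx0 := hpos x hx
    unfold W
    by_cases h : x ≤ n
    · have h' : (0 : ℤ) ≤ (n : ℤ) - x := by omega
      have h'' : ((n : ℤ) - x).toNat = n - x := by omega
      simp only [hx0, h, and_self, if_true, h', h'']
    · have h' : ¬ (0 : ℤ) ≤ (n : ℤ) - x := by omega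
      simp only [h, and_false, if_false, h']
  rw [subW, Nat.strongRecOn_eq]
  have hiff : (∃ x ∈ A, (if 0 < x ∧ x ≤ n then subW A seed (n - x)
      else seed ((n : ℤ) - (x : ℤ))) = 0) ↔ ∃ x ∈ A, W A seed ((n : ℤ) - x) = 0 :=
    exists_congr fun x => and_congr_right fun hx => by rw [key x hx]
  by_cases h : ∃ x ∈ A, W A seed ((n : ℤ) - x) = 0
  · rw [if_pos h]
    exact if_pos (hiff.2 h)
  · rw [if_neg h]
    exact if_neg (fun h' => h (hiff.1 h'))

theorem W_one_of_neg (A : Set ℕ) {n : ℤ} (hn : n < 0) : W A one n = 1 := by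
  simp [W, one, not_le.2 hn]

theorem W_of_nonneg (A : Set ℕ) (hpos : ∀ x ∈ A, 0 < x) (seed : ℤ → ℕ) {n : ℤ} (hn : 0 ≤ n)
    [Decidable (∃ x ∈ A, W A seed (n - x) = 0)] :
    W A seed n = if ∃ x ∈ A, W A seed (n - x) = 0 then 1 else 0 := by
  lift n to ℕ using hn
  rw [← subW_eq A hpos seed n]
  simp [W]

theorem W_one_eq_zero_or_one (A : Set ℕ) (hpos : ∀ x ∈ A, 0 < x) (n : ℤ) :
    W A one n = 0 ∨ W A one n = 1 := by
  classical
  rcases lt_or_ge n 0 with hn | hn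
  · exact Or.inr (W_one_of_neg A hn)
  · rw [W_of_nonneg A hpos one hn]
    split_ifs <;> simp

theorem W_one_eq_zero_iff (A : Set ℕ) (hpos : ∀ x ∈ A, 0 < x) (n : ℤ) :
    W A one n = 0 ↔ 0 ≤ n ∧ ∀ x ∈ A, W A one (n - x) ≠ 0 := by
  classical
  rcases lt_or_ge n 0 with hn | hn
  · simp [W_one_of_neg A hn, hn]
  · rw [W_of_nonneg A hpos one hn]
    simp [hn]

theorem W_one_add_ne_zero (A : Set ℕ) (hpos : ∀ x ∈ A, 0 < x) {n : ℤ} (hn : W A one n = 0)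
    {x : ℕ} (hx : x ∈ A) : W A one (n + x) ≠ 0 := by
  intro h
  apply ((W_one_eq_zero_iff A hpos _).1 h).2 x hx
  rwa [add_sub_cancel_right]

/-- Any `β + 1` consecutive nonnegative positions contain a zero. -/
theorem exists_zero_of_gap (A : Finset ℕ) (hA : A.Nonempty) (hpos : ∀ x ∈ (A : Set ℕ), 0 < x)
    (α' : ℕ) (hmax' : ∀ y ∈ A.erase (A.max' hA), y ≤ α') (n : ℕ) :
    ∃ d : ℕ, 0 < d ∧ d ≤ min (A.max' hA) (A.min' hA + α') + 1 ∧
      W A one ((n + d : ℕ) : ℤ) = 0 := by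
  by_contra! hno
  have hex : ∀ m : ℤ, 0 ≤ m → W A one m ≠ 0 → ∃ x ∈ A, W A one (m - x) = 0 := by
    intro m hm h
    by_contra! h'
    exact h ((W_one_eq_zero_iff A hpos m).2 ⟨hm, h'⟩)
  have hrun : ∀ m : ℤ, (n : ℤ) < m →
      m ≤ n + (min (A.max' hA) (A.min' hA + α') + 1 : ℕ) → W A one m ≠ 0 := by
    intro m h₁ h₂
    have := hno (m - n).toNat (by omega) (by omega)
    rwa [show ((n + (m - n).toNat : ℕ) : ℤ) = m by omega] at this
  have hmin := A.min'_mem hA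
  have hmin0 := hpos _ hmin
  set α := A.max' hA with hα
  set a := A.min' hA with ha
  have hle : ∀ x ∈ A, x ≤ α := fun x hx => A.le_max' x hx
  rcases le_total α (a + α') with hc | hc
  · rw [min_eq_left hc] at hrun
    obtain ⟨x, hx, hx0⟩ := hex (n + (α + 1 : ℕ)) (by omega) (hrun _ (by omega) le_rfl)
    have := hle x hx
    have := hpos x hx
    exact hrun _ (by omega) (by omega) hx0
  · rw [min_eq_right hc] at hrun
    have hlast : ∀ k : ℕ, α' < k → k ≤ a + α' + 1 →
        W A one ((n : ℤ) + k - α) = 0 := by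
      intro k h₁ h₂
      obtain ⟨x, hx, hx0⟩ := hex (n + k) (by omega) (hrun _ (by omega) (by omega))
      have := hpos x hx
      by_cases hxα : x = α
      · rwa [hxα] at hx0
      · have := hmax' x (Finset.mem_erase.2 ⟨hxα, hx⟩)
        exact absurd hx0 (hrun _ (by omega) (by omega))
    have h₁ := hlast (α' + 1) (by omega) (by omega)
    have h₂ := hlast (a + α' + 1) (by omega) (by omega)
    apply W_one_add_ne_zero A hpos h₁ hmin
    rw [← h₂]
    congr 1
    push_cast
    ring

/-- Equal windows following two zeros force all later values to agree. -/
theorem W_one_eq_of_window_eq (A : Finset ℕ) (hA : A.Nonempty)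
    (hpos : ∀ x ∈ (A : Set ℕ), 0 < x) {i j : ℕ}
    (hi : W A one i = 0) (hj : W A one j = 0)
    (h : ∀ k ∈ Finset.Icc 1 (A.max' hA) \ A, W A one ((i + k : ℕ) : ℤ) = 0 ↔
      W A one ((j + k : ℕ) : ℤ) = 0) (k : ℕ) :
    W A one ((i + k : ℕ) : ℤ) = W A one ((j + k : ℕ) : ℤ) := by
  have hbit := W_one_eq_zero_or_one (A : Set ℕ) hpos
  suffices H : W A one ((i + k : ℕ) : ℤ) = 0 ↔ W A one ((j + k : ℕ) : ℤ) = 0 by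
    have := hbit ((i + k : ℕ) : ℤ)
    have := hbit ((j + k : ℕ) : ℤ)
    omega
  induction k using Nat.strong_induction_on with
  | _ k ih =>
    rcases Nat.eq_zero_or_pos k with rfl | hk
    · simp [hi, hj]
    by_cases hkA : k ∈ A
    · have h₁ := W_one_add_ne_zero (A : Set ℕ) hpos hi hkA
      have h₂ := W_one_add_ne_zero (A : Set ℕ) hpos hj hkA
      push_cast
      exact iff_of_false h₁ h₂
    by_cases hkα : k ≤ A.max' hA
    · exact h k (Finset.mem_sdiff.2 ⟨Finset.mem_Icc.2 ⟨hk, hkα⟩, hkA⟩)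
    rw [W_one_eq_zero_iff _ hpos, W_one_eq_zero_iff _ hpos]
    refine and_congr (by omega) (forall₂_congr fun x hx => not_congr ?_)
    have hxα := A.le_max' x hx
    have hx0 := hpos x hx
    have := ih (k - x) (by omega)
    rwa [show ((i + (k - x) : ℕ) : ℤ) = ((i + k : ℕ) : ℤ) - x by omega,
      show ((j + (k - x) : ℕ) : ℤ) = ((j + k : ℕ) : ℤ) - x by omega] at this

theorem preper_add_per_le {w : ℤ → ℕ} {N p : ℕ} (hp : 0 < p)
    (h : ∀ n : ℤ, (N : ℤ) ≤ n → w n = w (n + p)) : preper w + per w ≤ N + p := by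
  have hmem : p ∈ {p : ℕ | 0 < p ∧ PeriodicOver w p} := ⟨hp, N, h⟩
  obtain ⟨-, N', hN'⟩ : 0 < per w ∧ PeriodicOver w (per w) := Nat.sInf_mem ⟨p, hmem⟩
  refine add_le_add (Nat.sInf_le ?_) (Nat.sInf_le hmem)
  intro n hn
  have hmul : ∀ (k : ℕ) (n : ℤ), (N : ℤ) ≤ n → w n = w (n + k * p) := by
    intro k
    induction k with
    | zero => simp
    | succ k ih =>
      intro n hn
      rw [ih n hn, h _ (hn.trans (le_add_of_nonneg_right (by positivity)))]
      push_cast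
      ring_nf
  have hbig : (N' : ℤ) ≤ N' * p := by
    exact_mod_cast Nat.le_mul_of_pos_right N' hp
  rw [hmul N' n hn, hN' _ (by omega), hmul N' (n + per w) (by omega)]
  ring_nf

/-- `preper(A) + per(A) ≤ (β + 1) · 2^(α - |A|)` where `α = max A`,
`a₁ = min A`, `α'` is the largest element of `A \ {α}` and `β = min(α, a₁ + α')`. -/
theorem stmt_2 (A : Finset ℕ) (hA : A.Nonempty) (hpos : ∀ x ∈ A, 0 < x)
    (hcard : 2 ≤ A.card)
    (α' : ℕ) (hmem : α' ∈ A.erase (A.max' hA))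
    (hmax' : ∀ y ∈ A.erase (A.max' hA), y ≤ α') :
    preper (W ↑A one) + per (W ↑A one)
      ≤ (min (A.max' hA) (A.min' hA + α') + 1) * 2 ^ (A.max' hA - A.card) := by
  classical
  have hpos' : ∀ x ∈ (A : Set ℕ), 0 < x := hpos
  choose d hd0 hdle hdz using exists_zero_of_gap A hA hpos' α' hmax'
  set B := min (A.max' hA) (A.min' hA + α') + 1
  obtain ⟨z, z_zero, zsucc⟩ : ∃ z : ℕ → ℕ, z 0 = 0 ∧ ∀ i, z (i + 1) = z i + d (z i) :=
    ⟨fun i => Nat.rec 0 (fun _ m => m + d m) i, rfl, fun _ => rfl⟩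
  have zmono : StrictMono z := strictMono_nat_of_lt_succ fun i => by
    rw [zsucc]
    exact Nat.lt_add_of_pos_right (hd0 _)
  have zle : ∀ i, z i ≤ B * i := by
    intro i
    induction i with
    | zero => exact z_zero.le
    | succ i ih =>
      rw [zsucc, Nat.mul_succ]
      exact add_le_add ih (hdle _)
  have zzero : ∀ i : ℕ, W A one (z i) = 0 := by
    rintro (_ | i)
    · refine (W_one_eq_zero_iff _ hpos' _).2 ⟨by omega, fun x hx => ?_⟩
      have := hpos x hx
      rw [W_one_of_neg _ (by omega)]
      exact one_ne_zero
    · rw [zsucc]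
      exact hdz (z i)
  set F := Finset.Icc 1 (A.max' hA) \ A with hF
  have hFcard : F.card = A.max' hA - A.card := by
    rw [hF, Finset.card_sdiff_of_subset, Nat.card_Icc, Nat.add_sub_cancel]
    exact fun x hx => Finset.mem_Icc.2 ⟨hpos x hx, A.le_max' x hx⟩
  set M := 2 ^ (A.max' hA - A.card)
  let f : ℕ → Finset ℕ := fun i => F.filter fun k => W A one ((z i + k : ℕ) : ℤ) = 0
  obtain ⟨i, hi, j, hj, hij, hfij⟩ :=
    Finset.exists_ne_map_eq_of_card_lt_of_maps_to (s := Finset.range (M + 1)) (t := F.powerset)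
      (f := f) (by rw [Finset.card_powerset, hFcard, Finset.card_range]; exact Nat.lt_succ_self M)
      (fun i _ => Finset.mem_powerset.2 (Finset.filter_subset _ _))
  wlog hlt : i < j generalizing i j
  · exact this j hj i hi hij.symm hfij.symm (by omega)
  have hz := zmono hlt
  have hwin := W_one_eq_of_window_eq A hA hpos' (zzero i) (zzero j) fun k (hk : k ∈ F) => by
    simpa [f, hk] using Finset.ext_iff.1 hfij k
  calc preper (W A one) + per (W A one) ≤ z i + (z j - z i) := by
        refine preper_add_per_le (by omega) fun n hn => ?_
        have := hwin (n - z i).toNat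
        rwa [show ((z i + (n - z i).toNat : ℕ) : ℤ) = n by omega,
          show ((z j + (n - z i).toNat : ℕ) : ℤ) = n + (z j - z i : ℕ) by omega] at this
    _ = z j := by omega
    _ ≤ B * j := zle j
    _ ≤ B * M := Nat.mul_le_mul_left B (Nat.lt_succ_iff.1 (Finset.mem_range.1 hj))
end

section
/- Let A be a nonempty set of positive integers (finite or infinite) and let p ≥ 1 be an integer such that w^A(n) = w^A(n + p) for all n ≥ 0 (that is, w^A is purely periodic over p). Then w^A(n) = w^B(n) for all n ≥ 0, where B = A ∩ {1, …, p}; in particular every element of A greater than p is redundant. -/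
open Classical in
/-- The defining recursion of the unseeded winning sequence. -/
theorem subW_one_eq (A : Set ℕ) (n : ℕ) :
    subW A one n =
      if ∃ x ∈ A, 0 < x ∧ x ≤ n ∧ subW A one (n - x) = 0 then 1 else 0 := by
  rw [subW, Nat.strongRecOn_eq]
  congr 1
  refine propext (exists_congr fun x => and_congr_right fun _ => ?_)
  split_ifs with hx
  · exact ⟨fun h => ⟨hx.1, hx.2, h⟩, fun h => h.2.2⟩
  · exact ⟨fun h => absurd h (by simp [one]), fun h => absurd ⟨h.1, h.2.1⟩ hx⟩

/-- In a purely periodic winning sequence, every winning position has a winning move of size at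
most the period. -/
theorem exists_move_le_of_periodic {A : Set ℕ} {p n : ℕ} (hp : 0 < p)
    (hper : Function.Periodic (subW A one) p)
    (hn : ∃ x ∈ A, 0 < x ∧ x ≤ n ∧ subW A one (n - x) = 0) :
    ∃ x ∈ A, x ≤ p ∧ 0 < x ∧ x ≤ n ∧ subW A one (n - x) = 0 := by
  classical
  have hmod : ∃ x ∈ A, 0 < x ∧ x ≤ n % p ∧ subW A one (n % p - x) = 0 := by
    by_contra hc
    have h₀ := subW_one_eq A (n % p)
    rw [if_neg hc, hper.map_mod_nat, subW_one_eq, if_pos hn] at h₀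
    exact one_ne_zero h₀
  obtain ⟨x, hxA, hx0, hxr, hx⟩ := hmod
  have hlt := Nat.mod_lt n hp
  have hdiv := Nat.mod_add_div n p
  refine ⟨x, hxA, by omega, hx0, hxr.trans (Nat.mod_le n p), ?_⟩
  have hsub : n - x = (n % p - x) + n / p * p := by
    rw [Nat.mul_comm (n / p)]
    omega
  rw [hsub, ← hx]
  exact hper.nat_mul (n / p) (n % p - x)

/-- Moves larger than the period of a purely periodic winning sequence are redundant. -/
theorem subW_one_eq_of_periodic {A : Set ℕ} {p : ℕ} (hp : 0 < p)
    (hper : Function.Periodic (subW A one) p) (n : ℕ) :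
    subW A one n = subW {x ∈ A | x ≤ p} one n := by
  classical
  induction n using Nat.strong_induction_on with
  | _ n ih =>
    rw [subW_one_eq A, subW_one_eq {x ∈ A | x ≤ p}]
    congr 1
    refine propext ⟨fun hn => ?_, ?_⟩
    · obtain ⟨x, hxA, hxp, hx0, hxn, hx⟩ := exists_move_le_of_periodic hp hper hn
      exact ⟨x, ⟨hxA, hxp⟩, hx0, hxn, by rw [← ih _ (by omega), hx]⟩
    · rintro ⟨x, ⟨hxA, _⟩, hx0, hxn, hx⟩
      exact ⟨x, hxA, hx0, hxn, by rw [ih _ (by omega), hx]⟩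

/-- if `w^A` is purely periodic over `p`, then `w^A = w^B` on `ℕ`,
where `B = A ∩ {1, …, p}`. -/
theorem stmt_5 (A : Set ℕ) (hA : A.Nonempty) (hpos : ∀ x ∈ A, 0 < x)
    (p : ℕ) (hp : 1 ≤ p)
    (h : ∀ n : ℤ, 0 ≤ n → W A one n = W A one (n + p)) :
    ∀ n : ℤ, 0 ≤ n → W A one n = W {x ∈ A | x ≤ p} one n := by
  intro n hn
  lift n to ℕ using hn
  rw [W_natCast, W_natCast]
  refine subW_one_eq_of_periodic hp (fun m => ?_) n
  have hm := h m (Int.natCast_nonneg m)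
  rw [← Nat.cast_add, W_natCast, W_natCast] at hm
  exact hm.symm
end

section
/- Let b ≥ 2 and let Y : ℤ → {0,1} satisfy Y(n) = Y(n + b + 1) for all n ∈ ℤ. Then Y satisfies the {1,b}-recurrence Y(n) = 1 − min(Y(n − 1), Y(n − b)) for all n ∈ ℤ if and only if there is no n with Y(n) = Y(n + 1) = 0 and no n with Y(n) = Y(n + 1) = Y(n + 2) = 1 (i.e. Y has no two consecutive 0's and no three consecutive 1's; equivalently, its cyclic word is a concatenation of the blocks 01 and 011 under some rotation). -/
/-- a `(b+1)`-periodic two-sided 0/1 sequence satisfies the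
`{1,b}`-recurrence iff it has no two consecutive 0's and no three consecutive 1's. -/
theorem stmt_13 (b : ℕ) (hb : 2 ≤ b) (Y : ℤ → ℕ)
    (hval : ∀ n : ℤ, Y n = 0 ∨ Y n = 1)
    (hper : ∀ n : ℤ, Y n = Y (n + ((b : ℤ) + 1))) :
    (∀ n : ℤ, Y n = 1 - min (Y (n - 1)) (Y (n - b))) ↔
    ((¬ ∃ n : ℤ, Y n = 0 ∧ Y (n + 1) = 0) ∧
     (¬ ∃ n : ℤ, Y n = 1 ∧ Y (n + 1) = 1 ∧ Y (n + 2) = 1)) := by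
  have hshift : ∀ n : ℤ, Y (n - b) = Y (n + 1) := fun n => by
    rw [hper (n - b)]
    congr 1
    ring
  simp only [hshift, not_exists, not_and]
  constructor
  · intro h
    refine ⟨fun n h0 h1 => ?_, fun n h0 h1 h2 => ?_⟩
    · have := h n
      omega
    · have := h (n + 1)
      rw [show n + 1 - 1 = n by ring, show n + 1 + 1 = n + 2 by ring] at this
      omega
  · rintro ⟨h00, h111⟩ n
    have hleft := h00 (n - 1)
    have hright := h00 n
    have hmid := h111 (n - 1)
    rw [show n - 1 + 1 = n by ring] at hleft hmid
    rw [show n - 1 + 2 = n + 1 by ring] at hmid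
    have hprev := hval (n - 1)
    have hcur := hval n
    have hnext := hval (n + 1)
    omega
end

section
/- Let a and b be distinct coprime positive integers, and let Y : ℤ → {0,1} satisfy Y(n) = Y(n + a + b) for all n ∈ ℤ. Define X : ℤ → {0,1} by X(n) = Y(a·n) (well defined up to the periodicity of Y, and X is itself periodic over a + b). Then Y satisfies the {a,b}-recurrence Y(n) = 1 − min(Y(n − a), Y(n − b)) for all n ∈ ℤ if and only if X satisfies the {1, a+b−1}-recurrence X(n) = 1 − min(X(n − 1), X(n − (a + b − 1))) for all n ∈ ℤ. -/
/-- A sequence of period `p` takes the same values at integers that differ by a multiple of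
`p`. -/
theorem apply_add_mul_of_periodic {α : Type*} {Y : ℤ → α} {p : ℤ}
    (hper : ∀ n : ℤ, Y n = Y (n + p)) (n k : ℤ) : Y (n + k * p) = Y n :=
  Function.Periodic.int_mul (fun m => (hper m).symm) k n

/-- for coprime `a ≠ b` and an `(a+b)`-periodic two-sided 0/1 sequence
`Y`, with `X(n) = Y(a·n)`, `Y` satisfies the `{a,b}`-recurrence iff `X` satisfies the
`{1, a+b-1}`-recurrence. -/
theorem stmt_15 (a b : ℕ) (ha : 0 < a) (hb : 0 < b) (hab : a ≠ b)
    (hcop : Nat.Coprime a b) (Y : ℤ → ℕ)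
    (hval : ∀ n : ℤ, Y n = 0 ∨ Y n = 1)
    (hper : ∀ n : ℤ, Y n = Y (n + ((a : ℤ) + b))) :
    (∀ n : ℤ, Y n = 1 - min (Y (n - a)) (Y (n - b))) ↔
    (∀ n : ℤ, Y ((a : ℤ) * n)
        = 1 - min (Y ((a : ℤ) * (n - 1))) (Y ((a : ℤ) * (n - ((a : ℤ) + b - 1))))) := by
  have hshift := apply_add_mul_of_periodic hper
  have hb' : ∀ n : ℤ, Y (a * (n - ((a : ℤ) + b - 1))) = Y (a * n - b) := fun n => by
    rw [← hshift (a * n - b) (1 - a)]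
    congr 1
    ring
  have ha' : ∀ n : ℤ, (a : ℤ) * (n - 1) = a * n - a := fun n => by ring
  simp only [hb', ha']
  refine ⟨fun h n => h (a * n), fun h m => ?_⟩
  obtain ⟨u, v, huv⟩ : IsCoprime (a : ℤ) (a + b) := by
    simpa using (Nat.isCoprime_iff_coprime.mpr hcop).mul_add_left_right 1
  have hm : ∀ c : ℤ, Y (m - c) = Y (a * (m * u) - c) := fun c => by
    rw [← hshift (a * (m * u) - c) (m * v)]
    congr 1
    linear_combination -m * huv
  have h0 := hm 0
  rw [sub_zero, sub_zero] at h0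
  rw [h0, hm a, hm b]
  exact h (m * u)
end
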